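/- arXiv:math/0609839 — 7 statements merged into one kernel-verified Lean document; each statement's English description precedes it below -/
import Mathlib

section
/- Let V be a finite-dimensional vector space over ℚ with a nondegenerate symmetric ℚ-bilinear form ψ, and let ω ∈ V_ℂ satisfy ψ_ℂ(ω,ω) = 0 and ψ_ℂ(ω, ω̄) a negative real number. Then the following are equivalent: (1) every ℚ-subspace W ⊆ V whose complexification satisfies W_ℂ = (W_ℂ ∩ ℂω) + (W_ℂ ∩ (ℂω + ℂω̄)^⊥) + (W_ℂ ∩ ℂω̄) is either 0 or all of V; (2) the only v ∈ V with ψ_ℂ(ω, v) = 0 is v = 0. -/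
open TensorProduct

/-- The conjugation on the complexification `ℂ ⊗[ℚ] V`, induced by complex conjugation
on the first tensor factor. -/
noncomputable def complexificationConj (V : Type*) [AddCommGroup V] [Module ℚ V] :
    ℂ ⊗[ℚ] V →ₗ[ℚ] ℂ ⊗[ℚ] V :=
  TensorProduct.map (Complex.conjAe.toLinearMap.restrictScalars ℚ) LinearMap.id

section Conjugation

variable {V : Type*} [AddCommGroup V] [Module ℚ V]

@[simp]
lemma complexificationConj_tmul (a : ℂ) (v : V) :
    complexificationConj V (a ⊗ₜ[ℚ] v) = (starRingEnd ℂ a) ⊗ₜ[ℚ] v :=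
  rfl

@[simp]
lemma complexificationConj_complexificationConj (x : ℂ ⊗[ℚ] V) :
    complexificationConj V (complexificationConj V x) = x := by
  induction x with
  | zero => simp
  | tmul a v => simp
  | add x y hx hy => simp [hx, hy]

lemma baseChange_complexificationConj (ψ : LinearMap.BilinForm ℚ V) (x y : ℂ ⊗[ℚ] V) :
    ψ.baseChange ℂ (complexificationConj V x) (complexificationConj V y) =
      starRingEnd ℂ (ψ.baseChange ℂ x y) := by
  induction x with
  | zero => simp
  | add x x' hx hx' => simp [hx, hx']
  | tmul a v =>
    induction y with
    | zero => simp
    | add y y' hy hy' => simp only [map_add, hy, hy']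
    | tmul b w =>
      simp [LinearMap.BilinForm.baseChange_tmul, Algebra.smul_def]

lemma complexificationConj_mem_baseChange {W : Submodule ℚ V} {x : ℂ ⊗[ℚ] V}
    (hx : x ∈ W.baseChange ℂ) : complexificationConj V x ∈ W.baseChange ℂ := by
  obtain ⟨y, rfl⟩ := hx
  induction y with
  | zero => simp
  | tmul a v => exact Submodule.tmul_mem_baseChange_of_mem _ v.2
  | add y z hy hz => simpa only [map_add] using add_mem hy hz

lemma complexificationConj_mem_baseChange_iff {W : Submodule ℚ V} {x : ℂ ⊗[ℚ] V} :
    complexificationConj V x ∈ W.baseChange ℂ ↔ x ∈ W.baseChange ℂ :=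
  ⟨fun h ↦ by simpa using complexificationConj_mem_baseChange h,
    complexificationConj_mem_baseChange⟩

/-- A rational vector orthogonal to `ω` is also orthogonal to the conjugate of `ω`. -/
lemma baseChange_complexificationConj_one_tmul_eq_zero {ψ : LinearMap.BilinForm ℚ V}
    {ω : ℂ ⊗[ℚ] V} {v : V} (h : ψ.baseChange ℂ ω (1 ⊗ₜ[ℚ] v) = 0) :
    ψ.baseChange ℂ (complexificationConj V ω) (1 ⊗ₜ[ℚ] v) = 0 := by
  simpa [h] using baseChange_complexificationConj ψ ω (1 ⊗ₜ[ℚ] v)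

end Conjugation

lemma Submodule.baseChange_le_iff_one_tmul_mem {R M : Type*} (A : Type*) [CommSemiring R]
    [Semiring A] [Algebra R A] [AddCommMonoid M] [Module R M] {p : Submodule R M}
    {N : Submodule A (A ⊗[R] M)} :
    p.baseChange A ≤ N ↔ ∀ m ∈ p, (1 : A) ⊗ₜ[R] m ∈ N := by
  rw [Submodule.baseChange_eq_span, Submodule.span_le]
  constructor
  · exact fun h m hm ↦ h ⟨m, hm, rfl⟩
  · rintro h _ ⟨m, hm, rfl⟩
    exact h m hm

lemma Submodule.inf_span_singleton_eq_bot_of_notMem {K M : Type*} [DivisionRing K]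
    [AddCommGroup M] [Module K M] {p : Submodule K M} {x : M} (hx : x ∉ p) :
    p ⊓ Submodule.span K {x} = ⊥ :=
  disjoint_iff.mp (Submodule.disjoint_span_singleton_of_notMem hx)

/-- Lemma 1.8 (`omega perp`): the weight two Hodge structure on `V` determined by the
period `ω` is simple if and only if no nonzero rational vector is orthogonal to `ω`. -/
theorem simple_iff_no_rational_vector_orthogonal_to_period
    (V : Type*) [AddCommGroup V] [Module ℚ V] [FiniteDimensional ℚ V]
    (ψ : LinearMap.BilinForm ℚ V) (hnd : ψ.Nondegenerate)
    (hsymm : ∀ v w, ψ v w = ψ w v)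
    (ω : ℂ ⊗[ℚ] V)
    (h1 : LinearMap.BilinForm.baseChange ℂ ψ ω ω = 0)
    (h2 : ∃ r : ℝ, r < 0 ∧
      LinearMap.BilinForm.baseChange ℂ ψ ω (complexificationConj V ω) = (r : ℂ)) :
    (∀ W : Submodule ℚ V,
        W.baseChange ℂ =
          (W.baseChange ℂ ⊓ Submodule.span ℂ {ω}) ⊔
          (W.baseChange ℂ ⊓ (LinearMap.BilinForm.baseChange ℂ ψ).orthogonal
              (Submodule.span ℂ {ω, complexificationConj V ω})) ⊔
          (W.baseChange ℂ ⊓ Submodule.span ℂ {complexificationConj V ω}) →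
        W = ⊥ ∨ W = ⊤)
      ↔ (∀ v : V, LinearMap.BilinForm.baseChange ℂ ψ ω ((1 : ℂ) ⊗ₜ[ℚ] v) = 0 → v = 0) := by
  constructor
  · intro hsimple v hv
    let W : Submodule ℚ V :=
      LinearMap.ker (((ψ.baseChange ℂ ω).restrictScalars ℚ).comp (TensorProduct.mk ℚ ℂ V 1))
    have hW : ∀ w ∈ W, ψ.baseChange ℂ ω (1 ⊗ₜ[ℚ] w) = 0 := fun w hw ↦ hw
    have hle : W.baseChange ℂ ≤ (ψ.baseChange ℂ).orthogonal
        (Submodule.span ℂ {ω, complexificationConj V ω}) := by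
      refine (Submodule.baseChange_le_iff_one_tmul_mem ℂ).mpr fun w hw n hn ↦ ?_
      obtain ⟨a, b, rfl⟩ := Submodule.mem_span_pair.mp hn
      simp [hW w hw,
        baseChange_complexificationConj_one_tmul_eq_zero (hW w hw)]
    rcases hsimple W (le_antisymm
      (le_sup_of_le_left (le_sup_of_le_right (le_inf le_rfl hle)))
      (sup_le (sup_le inf_le_left inf_le_left) inf_le_left)) with h | h
    · exact (Submodule.mem_bot ℚ).mp (h ▸ (show v ∈ W from hv))
    · obtain ⟨r, hr, hωr⟩ := h2
      rw [h, Submodule.baseChange_top] at hle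
      have h0 : ψ.baseChange ℂ ω (complexificationConj V ω) = 0 :=
        hle Submodule.mem_top ω (Submodule.subset_span (Set.mem_insert _ _))
      rw [hωr] at h0
      exact absurd (Complex.ofReal_eq_zero.mp h0) hr.ne
  · intro hperp W hdecomp
    by_cases hω : ω ∈ W.baseChange ℂ
    · right
      have hrefl : ψ.IsRefl := fun x y h ↦ (hsymm y x).trans h
      have hbot : ψ.orthogonal W = ⊥ := by
        refine (Submodule.eq_bot_iff _).mpr fun v hv ↦ hperp v ?_
        have hle : W.baseChange ℂ ≤ LinearMap.ker ((ψ.baseChange ℂ).flip (1 ⊗ₜ[ℚ] v)) := by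
          refine (Submodule.baseChange_le_iff_one_tmul_mem ℂ).mpr fun w hw ↦ ?_
          have hwv : ψ w v = 0 := hv w hw
          simp [hwv, LinearMap.BilinForm.baseChange_tmul]
        exact hle hω
      rw [← LinearMap.BilinForm.orthogonal_orthogonal hnd hrefl W, hbot,
        LinearMap.BilinForm.orthogonal_bot]
    · left
      rw [Submodule.inf_span_singleton_eq_bot_of_notMem hω,
        Submodule.inf_span_singleton_eq_bot_of_notMem
          (complexificationConj_mem_baseChange_iff.not.mpr hω), bot_sup_eq, sup_bot_eq] at hdecomp
      refine (Submodule.eq_bot_iff _).mpr fun w hw ↦ hperp w ?_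
      exact (hdecomp.le.trans inf_le_right) (Submodule.tmul_mem_baseChange_of_mem 1 hw) ω
        (Submodule.subset_span (Set.mem_insert _ _))
end

section
/- Let F be a number field, V a finite-dimensional F-vector space, and ψ : V × V → ℚ a ℚ-bilinear form satisfying ψ(a•v, w) = ψ(v, a•w) for all a ∈ F and v, w ∈ V. Then there exists a unique F-bilinear form Φ : V × V → F such that ψ(v, w) = Tr_{F/ℚ}(Φ(v, w)) for all v, w ∈ V. -/
theorem eq_of_forall_trace_mul_eq {K L : Type*} [Field K] [Field L] [Algebra K L]
    [FiniteDimensional K L] [Algebra.IsSeparable K L] {x y : L}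
    (h : ∀ a, Algebra.trace K L (x * a) = Algebra.trace K L (y * a)) : x = y :=
  sub_eq_zero.mp <| (traceForm_nondegenerate K L).1 (x - y) fun a => by
    rw [Algebra.traceForm_apply, sub_mul, map_sub, h, sub_self]

theorem exists_forall_trace_mul_eq {K L : Type*} [Field K] [Field L] [Algebra K L]
    [FiniteDimensional K L] [Algebra.IsSeparable K L] (f : Module.Dual K L) :
    ∃ x, ∀ a, Algebra.trace K L (x * a) = f a :=
  ⟨((Algebra.traceForm K L).toDual (traceForm_nondegenerate K L)).symm f, fun a => by
    rw [← Algebra.traceForm_apply, LinearMap.BilinForm.apply_toDual_symm_apply]⟩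

/-- Lemma 2.6 (`dec psi`): a ℚ-bilinear form `ψ` on an `F`-vector space `V` which is
`F`-self-adjoint is the trace of a unique `F`-bilinear form `Φ`. -/
theorem exists_unique_trace_form
    (F : Type*) [Field F] [NumberField F]
    (V : Type*) [AddCommGroup V] [Module F V] [Module ℚ V] [IsScalarTower ℚ F V]
    [FiniteDimensional F V]
    (ψ : LinearMap.BilinForm ℚ V)
    (hψ : ∀ (a : F) (v w : V), ψ (a • v) w = ψ v (a • w)) :
    ∃! Φ : V →ₗ[F] V →ₗ[F] F, ∀ v w : V, ψ v w = Algebra.trace ℚ F (Φ v w) := by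
  have key (v w : V) : ∃ x : F, ∀ a : F, Algebra.trace ℚ F (x * a) = ψ v (a • w) :=
    exists_forall_trace_mul_eq
      (ψ v ∘ₗ (LinearMap.toSpanSingleton F V w).restrictScalars ℚ)
  choose φ hφ using key
  refine ⟨LinearMap.mk₂ F φ ?_ ?_ ?_ ?_, fun v w => ?_, fun Φ hΦ => ?_⟩
  · intro v v' w
    refine eq_of_forall_trace_mul_eq (K := ℚ) fun a => ?_
    simp only [add_mul, map_add, hφ, LinearMap.add_apply]
  · intro c v w
    refine eq_of_forall_trace_mul_eq (K := ℚ) fun a => ?_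
    rw [smul_eq_mul, mul_assoc, mul_left_comm, hφ, hφ, hψ, smul_smul]
  · intro v w w'
    refine eq_of_forall_trace_mul_eq (K := ℚ) fun a => ?_
    simp only [add_mul, map_add, hφ, smul_add]
  · intro c v w
    refine eq_of_forall_trace_mul_eq (K := ℚ) fun a => ?_
    rw [smul_eq_mul, mul_assoc, mul_left_comm, hφ, hφ, smul_smul, mul_comm]
  · simpa using (hφ v w 1).symm
  · ext v w
    refine eq_of_forall_trace_mul_eq (K := ℚ) fun a => ?_
    rw [LinearMap.mk₂_apply, hφ, hΦ, map_smul, smul_eq_mul, mul_comm]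
end

section
/- Let F be a number field, V an F-vector space of finite F-dimension m, and ψ : V × V → ℚ a nondegenerate ℚ-bilinear form. Let a ∈ F be such that N_{F/ℚ}(a)^m is not the square of a rational number. Then there is no ℚ-linear automorphism g of V with ψ(g(v), g(w)) = ψ(a•v, w) for all v, w ∈ V; that is, (V, ψ_a) and (V, ψ) are not isometric over ℚ. -/
/-- If `g` is an isometry from the form `B (f ·) ·` to the nondegenerate form `B`, then
`det g ^ 2 = det f`. -/
theorem LinearMap.Nondegenerate.det_sq_eq_det {K V : Type*} [Field K] [AddCommGroup V]
    [Module K V] [FiniteDimensional K V] {B : LinearMap.BilinForm K V} (hB : B.Nondegenerate)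
    {f g : V →ₗ[K] V} (h : ∀ v w, B (g v) (g w) = B (f v) w) :
    LinearMap.det g ^ 2 = LinearMap.det f := by
  classical
  let b := Module.finBasis K V
  have hdet : (LinearMap.toMatrix₂ b b B).det ≠ 0 :=
    (LinearMap.nondegenerate_iff_det_ne_zero b).1 hB
  have hcomp : B.compl₁₂ g g = LinearMap.comp B f := LinearMap.ext₂ h
  have hmat := congrArg (fun C ↦ (LinearMap.toMatrix₂ b b C).det) hcomp
  simp only [LinearMap.toMatrix₂_compl₁₂ b b b b, LinearMap.toMatrix₂_comp b b b,
    Matrix.det_mul, Matrix.det_transpose, LinearMap.det_toMatrix] at hmat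
  apply mul_right_cancel₀ hdet
  linear_combination hmat

/-- The determinant over `K` of multiplication by `a : F` on an `F`-vector space `V` is
`N_{F/K}(a) ^ dim_F V`. -/
theorem LinearMap.det_restrictScalars_lsmul {K F V : Type*} [Field K] [Field F] [Algebra K F]
    [FiniteDimensional K F] [AddCommGroup V] [Module F V] [Module K V] [IsScalarTower K F V]
    [FiniteDimensional F V] (a : F) :
    LinearMap.det ((LinearMap.lsmul F V a).restrictScalars K) =
      Algebra.norm K a ^ Module.finrank F V := by
  have : LinearMap.lsmul F V a = a • LinearMap.id := rfl
  rw [LinearMap.det_restrictScalars, this, LinearMap.det_smul, LinearMap.det_id, mul_one, map_pow]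

/-- If `N_{F/ℚ}(a)^m` is not a square in ℚ, then the twisted form `ψ_a(v,w) = ψ(a•v,w)`
is not isometric to the nondegenerate form `ψ` over ℚ. -/
theorem not_isometric_twist (F : Type*) [Field F] [NumberField F]
    (V : Type*) [AddCommGroup V] [Module F V] [Module ℚ V] [IsScalarTower ℚ F V]
    [FiniteDimensional F V] (m : ℕ) (hm : Module.finrank F V = m)
    (ψ : LinearMap.BilinForm ℚ V) (hnd : ψ.Nondegenerate) (a : F)
    (ha : ¬ ∃ q : ℚ, q ^ 2 = Algebra.norm ℚ a ^ m) :
    ¬ ∃ g : V ≃ₗ[ℚ] V, ∀ v w : V, ψ (g v) (g w) = ψ (a • v) w := by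
  rintro ⟨g, hg⟩
  have : FiniteDimensional ℚ V := FiniteDimensional.trans ℚ F V
  refine ha ⟨LinearMap.det (g : V →ₗ[ℚ] V), ?_⟩
  rw [← hm, ← LinearMap.det_restrictScalars_lsmul (V := V) a]
  exact hnd.det_sq_eq_det hg
end

section
/- Let F be a totally real number field, V a nonzero finite-dimensional F-vector space, and Φ : V × V → F a symmetric F-bilinear form such that the ℚ-bilinear form ψ(v, w) := Tr_{F/ℚ}(Φ(v, w)) is positive definite on V. Then for a ∈ F, the ℚ-valued quadratic form v ↦ Tr_{F/ℚ}(a·Φ(v, v)) is positive definite on V if and only if a is totally positive, i.e. σ(a) > 0 for every ring homomorphism σ : F → ℝ. -/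
open NumberField Filter Topology

section TotallyReal

variable {F : Type*} [Field F] [NumberField F]

theorem NumberField.trace_eq_sum_re (x : F) :
    ((Algebra.trace ℚ F x : ℚ) : ℝ) = ∑ φ : F →+* ℂ, (φ x).re := by
  have h : ((Algebra.trace ℚ F x : ℚ) : ℂ) = ∑ φ : F →ₐ[ℚ] ℂ, φ x := by
    simpa using trace_eq_sum_embeddings (K := ℚ) (L := F) ℂ (x := x)
  rw [← Fintype.sum_equiv (RingHom.equivRatAlgHom F ℂ) (fun φ => φ x) (fun φ => φ x)
    fun _ => by simp [RingHom.equivRatAlgHom_apply]] at h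
  simpa using congrArg Complex.re h

/-- In a totally real field, an element can be large at one embedding and small at all others. -/
theorem NumberField.exists_one_lt_norm_lt_one (htr : ∀ φ : F →+* ℂ, ∀ x : F, (φ x).im = 0)
    (φ : F →+* ℂ) : ∃ x : F, 1 < ‖φ x‖ ∧ ∀ ψ : F →+* ℂ, ψ ≠ φ → ‖ψ x‖ < 1 := by
  obtain ⟨x, hx, hx'⟩ := AbsoluteValue.exists_one_lt_lt_one_pi_of_not_isEquiv
    (v := fun w : InfinitePlace F => w.1) (fun w => w.isNontrivial)
    (fun _ _ h => InfinitePlace.eq_iff_isEquiv.not.mp h) (InfinitePlace.mk φ)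
  refine ⟨x, hx, fun ψ hψ => hx' (InfinitePlace.mk ψ) fun h => hψ ?_⟩
  rcases InfinitePlace.mk_eq_iff.mp h with h | h
  · exact h
  · rw [← h]
    ext y
    exact (Complex.conj_eq_iff_im.mpr (htr ψ y)).symm

/-- If the trace form `x ↦ Tr (c * x ^ 2)` of a totally real field is positive definite, then `c`
is positive at every embedding. -/
theorem NumberField.re_pos_of_trace_mul_sq_pos (htr : ∀ φ : F →+* ℂ, ∀ x : F, (φ x).im = 0)
    {c : F} (hc : ∀ x : F, x ≠ 0 → 0 < Algebra.trace ℚ F (c * x ^ 2)) (φ : F →+* ℂ) :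
    0 < (φ c).re := by
  classical
  have eq_re (ψ : F →+* ℂ) (y : F) : ψ y = ((ψ y).re : ℂ) :=
    Complex.ext rfl (by simpa using htr ψ y)
  have hc0 : c ≠ 0 := by
    rintro rfl
    simpa using hc 1 one_ne_zero
  have hφc : (φ c).re ≠ 0 := fun h => hc0 <| (map_eq_zero φ).mp <| by rw [eq_re, h]; simp
  by_contra! hle
  have hlt : (φ c).re < 0 := lt_of_le_of_ne hle hφc
  obtain ⟨x, hx, hx'⟩ := exists_one_lt_norm_lt_one htr φ
  have hx0 : x ≠ 0 := by
    rintro rfl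
    norm_num at hx
  have re_pow (ψ : F →+* ℂ) (n : ℕ) :
      (ψ (c * (x ^ n) ^ 2)).re = (ψ c).re * (‖ψ x‖ ^ 2) ^ n := by
    rw [map_mul, map_pow, map_pow, eq_re ψ c, eq_re ψ x, Complex.norm_real, Real.norm_eq_abs,
      sq_abs, pow_right_comm]
    norm_cast
  have hlim : Tendsto (fun n : ℕ => ∑ ψ ∈ Finset.univ.erase φ, (ψ c).re * (‖ψ x‖ ^ 2) ^ n)
      atTop (𝓝 0) := by
    rw [← Finset.sum_const_zero (s := Finset.univ.erase φ)]
    refine tendsto_finsetSum _ fun ψ hψ => ?_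
    have h1 : ‖ψ x‖ ^ 2 < 1 :=
      pow_lt_one₀ (norm_nonneg _) (hx' ψ (Finset.ne_of_mem_erase hψ)) two_ne_zero
    simpa using (tendsto_pow_atTop_nhds_zero_of_lt_one (by positivity) h1).const_mul (ψ c).re
  obtain ⟨n, hn⟩ := (hlim.eventually_lt_const (neg_pos.mpr hlt)).exists
  have htrace : (0 : ℝ) < (Algebra.trace ℚ F (c * (x ^ n) ^ 2) : ℚ) := by
    exact_mod_cast hc _ (pow_ne_zero n hx0)
  rw [trace_eq_sum_re, ← Finset.add_sum_erase _ _ (Finset.mem_univ φ)] at htrace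
  simp only [re_pow] at htrace
  have h1 : 1 ≤ (‖φ x‖ ^ 2) ^ n := one_le_pow₀ (one_le_pow₀ hx.le)
  nlinarith

end TotallyReal


/-- Lemma 4.2 (`mult of pols`), positivity part: if `ψ = Tr_{F/ℚ} ∘ Φ` is positive
definite on a nonzero `F`-vector space `V`, then `v ↦ Tr_{F/ℚ}(a · Φ(v, v))` is positive
definite iff `a ∈ F` is totally positive. -/
theorem twisted_trace_form_posDef_iff_totally_positive
    (F : Type*) [Field F] [NumberField F]
    (htr : ∀ φ : F →+* ℂ, ∀ x : F, (φ x).im = 0)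
    (V : Type*) [AddCommGroup V] [Module F V] [Nontrivial V] [FiniteDimensional F V]
    (Φ : V →ₗ[F] V →ₗ[F] F) (hsymm : ∀ v w : V, Φ v w = Φ w v)
    (hpos : ∀ v : V, v ≠ 0 → 0 < Algebra.trace ℚ F (Φ v v)) (a : F) :
    (∀ v : V, v ≠ 0 → 0 < Algebra.trace ℚ F (a * Φ v v)) ↔
      (∀ σ : F →+* ℝ, 0 < σ a) := by
  have re_mul (φ : F →+* ℂ) (x y : F) : (φ (x * y)).re = (φ x).re * (φ y).re := by
    simp [htr φ]
  have smul_smul_eq (v : V) (x : F) : Φ (x • v) (x • v) = Φ v v * x ^ 2 := by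
    simp only [map_smul, LinearMap.smul_apply, smul_eq_mul]
    ring
  have hΦ (v : V) (hv : v ≠ 0) (φ : F →+* ℂ) : 0 < (φ (Φ v v)).re :=
    re_pos_of_trace_mul_sq_pos htr
      (fun x hx => by simpa only [smul_smul_eq] using hpos (x • v) (smul_ne_zero hx hv)) φ
  constructor
  · intro h σ
    obtain ⟨v, hv⟩ := exists_ne (0 : V)
    have hmul : 0 < ((Complex.ofRealHom.comp σ) (a * Φ v v)).re :=
      re_pos_of_trace_mul_sq_pos htr
        (fun x hx => by
          simpa only [smul_smul_eq, mul_assoc] using h (x • v) (smul_ne_zero hx hv)) _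
    rw [re_mul] at hmul
    simpa using pos_of_mul_pos_left hmul (hΦ v hv _).le
  · intro h v hv
    have htrace : (0 : ℝ) < (Algebra.trace ℚ F (a * Φ v v) : ℚ) := by
      rw [trace_eq_sum_re]
      refine Finset.sum_pos (fun φ _ => ?_) Finset.univ_nonempty
      rw [re_mul]
      refine mul_pos ?_ (hΦ v hv φ)
      have hφ : ComplexEmbedding.IsReal φ :=
        RingHom.ext fun y => Complex.conj_eq_iff_im.mpr (htr φ y)
      rw [← hφ.coe_embedding_apply a, Complex.ofReal_re]
      exact h hφ.embedding
    exact_mod_cast htrace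
end

section
/- Let F be a totally real number field of degree n, let ε : F → ℝ be one of its real embeddings, let m ≥ 3, and let a₁, …, a_m ∈ F satisfy: ε(a₁) < 0, ε(a₂) < 0, ε(a_k) > 0 for 3 ≤ k ≤ m, and σ(a_k) > 0 for all k whenever σ : F → ℝ is a real embedding with σ ≠ ε. Define the ℚ-bilinear form ψ on V = F^m by ψ(x, y) = Tr_{F/ℚ}(Σ_{k=1}^m a_k x_k y_k). Then the ℝ-bilinear extension ψ_ℝ on V_ℝ := ℝ ⊗_ℚ V has signature ((nm−2)+, 2−): there exist subspaces P, N of V_ℝ with V_ℝ = P ⊕ N, dim_ℝ P = nm − 2, dim_ℝ N = 2, ψ_ℝ positive definite on P, ψ_ℝ negative definite on N, and ψ_ℝ(P, N) = 0. -/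
open TensorProduct

/-- A diagonal real form, negative exactly on the coordinates in `T`, splits orthogonally into
a negative definite subspace of dimension `#T` and a positive definite complement. -/
lemma exists_isCompl_posDef_negDef {M ι : Type*} [AddCommGroup M] [Module ℝ M] [Fintype ι]
    [DecidableEq ι] (e : M ≃ₗ[ℝ] (ι → ℝ)) (w : ι → ℝ) (T : Finset ι)
    (hneg : ∀ i ∈ T, w i < 0) (hpos : ∀ i ∉ T, 0 < w i)
    (B : LinearMap.BilinForm ℝ M) (hB : ∀ x y, B x y = ∑ i, w i * e x i * e y i) :
    ∃ P N : Submodule ℝ M, IsCompl P N ∧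
      Module.finrank ℝ P = Fintype.card ι - T.card ∧ Module.finrank ℝ N = T.card ∧
      (∀ x ∈ P, x ≠ 0 → 0 < B x x) ∧ (∀ y ∈ N, y ≠ 0 → B y y < 0) ∧
      (∀ x ∈ P, ∀ y ∈ N, B x y = 0) := by
  have hM : Module.Finite ℝ M := Module.Finite.equiv e.symm
  let K (S : Finset ι) : Submodule ℝ (ι → ℝ) :=
    ⨅ i ∈ (S : Set ι), LinearMap.ker (LinearMap.proj i : (ι → ℝ) →ₗ[ℝ] ℝ)
  have memK (S : Finset ι) (x : M) : x ∈ (K S).comap e.toLinearMap ↔ ∀ i ∈ S, e x i = 0 := by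
    simp [K, Submodule.mem_iInf]
  have rankK (S : Finset ι) : Module.finrank ℝ ((K S).comap e.toLinearMap) = (Sᶜ).card := by
    have h := (LinearEquiv.ofSubmodule' e (K S)).trans
      (LinearMap.iInfKerProjEquiv ℝ (fun _ : ι ↦ ℝ) (I := ((Sᶜ : Finset ι) : Set ι))
        (J := (S : Set ι)) (by simpa using disjoint_compl_left)
        (by simp))
    rw [h.finrank_eq]
    simp [Finset.card_compl]
  have hx (x : M) (h : x ≠ 0) : ∃ i, e x i ≠ 0 := by
    by_contra! h'
    exact h (e.map_eq_zero_iff.1 (funext h'))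
  have hcard : Module.finrank ℝ M = Fintype.card ι := by simp [e.finrank_eq]
  have hT : T.card ≤ Fintype.card ι := Finset.card_le_univ T
  refine ⟨(K T).comap e.toLinearMap, (K Tᶜ).comap e.toLinearMap, ?_, ?_, ?_, ?_, ?_, ?_⟩
  · refine (Submodule.isCompl_iff_disjoint _ _ ?_).2 ?_
    · rw [rankK, rankK, compl_compl, Finset.card_compl, hcard]
      omega
    · rw [Submodule.disjoint_def]
      intro x h1 h2
      by_contra h
      obtain ⟨i, hi⟩ := hx x h
      rw [memK] at h1 h2
      by_cases hiT : i ∈ T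
      · exact hi (h1 i hiT)
      · exact hi (h2 i (Finset.mem_compl.2 hiT))
  · rw [rankK, Finset.card_compl]
  · rw [rankK, compl_compl]
  · intro x h1 h
    rw [memK] at h1
    obtain ⟨i, hi⟩ := hx x h
    rw [hB]
    refine Finset.sum_pos' (fun j _ ↦ ?_) ⟨i, Finset.mem_univ _, ?_⟩
    · by_cases hj : j ∈ T
      · simp [h1 j hj]
      · rw [mul_assoc]
        exact mul_nonneg (hpos j hj).le (mul_self_nonneg _)
    · rw [mul_assoc]
      exact mul_pos (hpos i fun hiT ↦ hi (h1 i hiT)) (mul_self_pos.2 hi)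
  · intro x h1 h
    rw [memK] at h1
    obtain ⟨i, hi⟩ := hx x h
    rw [hB]
    refine Finset.sum_neg' (fun j _ ↦ ?_) ⟨i, Finset.mem_univ _, ?_⟩
    · by_cases hj : j ∈ T
      · rw [mul_assoc]
        exact mul_nonpos_of_nonpos_of_nonneg (hneg j hj).le (mul_self_nonneg _)
      · simp [h1 j (Finset.mem_compl.2 hj)]
    · rw [mul_assoc]
      refine mul_neg_of_neg_of_pos (hneg i ?_) (mul_self_pos.2 hi)
      by_contra hiT
      exact hi (h1 i (Finset.mem_compl.2 hiT))
  · intro x h1 y h2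
    rw [memK] at h1 h2
    rw [hB]
    refine Finset.sum_eq_zero fun i _ ↦ ?_
    by_cases hi : i ∈ T
    · simp [h1 i hi]
    · simp [h2 i (Finset.mem_compl.2 hi)]

section TotallyReal

variable (F : Type*) [Field F]

/-- Composition with `ℝ → ℂ` identifies the real and complex embeddings of a totally real field. -/
lemma bijective_ofRealHom_comp (htr : ∀ φ : F →+* ℂ, ∀ x : F, (φ x).im = 0) :
    Function.Bijective (fun σ : F →+* ℝ ↦ Complex.ofRealHom.comp σ) := by
  refine ⟨fun σ τ h ↦ RingHom.ext fun x ↦ Complex.ofReal_injective (RingHom.congr_fun h x),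
    fun φ ↦ ?_⟩
  have hφ : NumberField.ComplexEmbedding.IsReal φ :=
    NumberField.ComplexEmbedding.isReal_iff.2 <|
      RingHom.ext fun x ↦ Complex.conj_eq_iff_im.2 (htr φ x)
  exact ⟨hφ.embedding, RingHom.ext fun x ↦ hφ.coe_embedding_apply x⟩

variable [NumberField F]

lemma card_realEmbeddings (htr : ∀ φ : F →+* ℂ, ∀ x : F, (φ x).im = 0) :
    Fintype.card (F →+* ℝ) = Module.finrank ℚ F :=
  (Fintype.card_of_bijective (bijective_ofRealHom_comp F htr)).trans
    (NumberField.Embeddings.card F ℂ)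

lemma trace_eq_sum_realEmbeddings (htr : ∀ φ : F →+* ℂ, ∀ x : F, (φ x).im = 0) (x : F) :
    ((Algebra.trace ℚ F x : ℚ) : ℝ) = ∑ σ : F →+* ℝ, σ x := by
  apply Complex.ofReal_injective
  have h : ((Algebra.trace ℚ F x : ℚ) : ℂ) = ∑ φ : F →+* ℂ, φ x := by
    rw [← eq_ratCast (algebraMap ℚ ℂ), trace_eq_sum_embeddings ℂ (K := ℚ) (x := x)]
    exact Fintype.sum_equiv (RingHom.equivRatAlgHom F ℂ).symm _ _ fun _ ↦ rfl
  rw [Complex.ofReal_ratCast, h, Complex.ofReal_sum]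
  exact ((bijective_ofRealHom_comp F htr).sum_comp fun φ : F →+* ℂ ↦ φ x).symm

/-- The map `ℝ ⊗ F^m → ℝ^(Hom(F, ℝ) × m)` given by the real embeddings. -/
noncomputable def realEmbeddingsMap (m : ℕ) :
    ℝ ⊗[ℚ] (Fin m → F) →ₗ[ℝ] ((F →+* ℝ) × Fin m → ℝ) :=
  LinearMap.pi fun p ↦
    (p.1.toRatAlgHom.toLinearMap ∘ₗ (LinearMap.proj p.2 : (Fin m → F) →ₗ[ℚ] F)).liftBaseChange ℝ

lemma realEmbeddingsMap_tmul (m : ℕ) (r : ℝ) (x : Fin m → F) (p : (F →+* ℝ) × Fin m) :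
    realEmbeddingsMap F m (r ⊗ₜ x) p = r * p.1 (x p.2) := by
  simp [realEmbeddingsMap]

lemma realEmbeddingsMap_surjective (m : ℕ) : Function.Surjective (realEmbeddingsMap F m) := by
  classical
  rw [← LinearMap.range_eq_top]
  by_contra h
  obtain ⟨f, hf, hle⟩ := Submodule.exists_le_ker_of_lt_top _ (lt_top_iff_ne_top.2 h)
  have hli : LinearIndependent ℝ (fun σ : F →+* ℝ ↦ (σ : F → ℝ)) :=
    (linearIndependent_monoidHom F ℝ).comp (fun σ : F →+* ℝ ↦ (σ : F →* ℝ))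
      fun _ _ h ↦ RingHom.coe_monoidHom_injective h
  refine hf ((Pi.basisFun ℝ _).ext fun p ↦ ?_)
  obtain ⟨σ, k⟩ := p
  simp only [Pi.basisFun_apply, LinearMap.zero_apply]
  refine Fintype.linearIndependent_iff.1 hli (fun τ ↦ f (Pi.single (τ, k) 1)) (funext fun y ↦ ?_) σ
  have h0 : f (realEmbeddingsMap F m (1 ⊗ₜ Pi.single k y)) = 0 := hle ⟨_, rfl⟩
  rw [LinearMap.pi_apply_eq_sum_univ f, Fintype.sum_prod_type] at h0
  simp only [realEmbeddingsMap_tmul, one_mul, smul_eq_mul] at h0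
  rw [Finset.sum_apply, Pi.zero_apply, ← h0]
  refine Finset.sum_congr rfl fun τ _ ↦ ?_
  rw [Finset.sum_eq_single k]
  · have hs : (Pi.single (τ, k) 1 : (F →+* ℝ) × Fin m → ℝ) =
        fun j ↦ if (τ, k) = j then 1 else 0 :=
      funext fun j ↦ by simp [Pi.single_apply, eq_comm]
    simp [hs, mul_comm]
  · intro j _ hj
    simp [hj]
  · simp

/-- The isomorphism `ℝ ⊗ F^m ≃ ℝ^(Hom(F, ℝ) × m)` for a totally real field `F`. -/
noncomputable def realEmbeddingsEquiv (htr : ∀ φ : F →+* ℂ, ∀ x : F, (φ x).im = 0) (m : ℕ) :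
    ℝ ⊗[ℚ] (Fin m → F) ≃ₗ[ℝ] ((F →+* ℝ) × Fin m → ℝ) :=
  LinearEquiv.ofBijective (realEmbeddingsMap F m) <| by
    have h := realEmbeddingsMap_surjective F m
    refine ⟨(LinearMap.injective_iff_surjective_of_finrank_eq_finrank ?_).2 h, h⟩
    simp [card_realEmbeddings F htr, Module.finrank_pi_fintype, mul_comm]

lemma baseChange_trace_form_apply (htr : ∀ φ : F →+* ℂ, ∀ x : F, (φ x).im = 0) (m : ℕ)
    (a : Fin m → F) (ψ : LinearMap.BilinForm ℚ (Fin m → F))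
    (hψ : ∀ x y : Fin m → F, ψ x y = Algebra.trace ℚ F (∑ k, a k * x k * y k))
    (x y : ℝ ⊗[ℚ] (Fin m → F)) :
    LinearMap.BilinForm.baseChange ℝ ψ x y =
      ∑ p : (F →+* ℝ) × Fin m, p.1 (a p.2) * realEmbeddingsMap F m x p *
        realEmbeddingsMap F m y p := by
  induction x with
  | zero => simp
  | add x₁ x₂ h₁ h₂ => simp [h₁, h₂, mul_add, add_mul, Finset.sum_add_distrib]
  | tmul r x =>
    induction y with
    | zero => simp
    | add y₁ y₂ h₁ h₂ =>
      rw [map_add, h₁, h₂, ← Finset.sum_add_distrib]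
      simp [mul_add]
    | tmul s y =>
      rw [LinearMap.BilinForm.baseChange_tmul, hψ, Rat.smul_def,
        trace_eq_sum_realEmbeddings F htr, Fintype.sum_prod_type, Finset.sum_mul]
      refine Finset.sum_congr rfl fun σ _ ↦ ?_
      simp only [realEmbeddingsMap_tmul, map_sum, map_mul, Finset.sum_mul]
      refine Finset.sum_congr rfl fun k _ ↦ ?_
      ring

end TotallyReal

/-- From the proof of Lemma 3.2 (`no m=2`): the trace form `ψ(x,y) = Tr_{F/ℚ}(Σ aₖ xₖ yₖ)`
on `V = F^m`, with `a₁, a₂` negative at one real embedding `ε` and all other values of the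
`aₖ` at the real embeddings positive, has signature `((nm−2)+, 2−)` over ℝ. -/
theorem trace_form_signature
    (F : Type*) [Field F] [NumberField F]
    (htr : ∀ φ : F →+* ℂ, ∀ x : F, (φ x).im = 0)
    (ε : F →+* ℝ) (m : ℕ) (hm : 3 ≤ m) (a : Fin m → F)
    (h0 : ε (a ⟨0, by omega⟩) < 0) (h1 : ε (a ⟨1, by omega⟩) < 0)
    (h2 : ∀ k : Fin m, 2 ≤ (k : ℕ) → 0 < ε (a k))
    (hσ : ∀ σ : F →+* ℝ, σ ≠ ε → ∀ k : Fin m, 0 < σ (a k))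
    (ψ : LinearMap.BilinForm ℚ (Fin m → F))
    (hψ : ∀ x y : Fin m → F, ψ x y = Algebra.trace ℚ F (∑ k, a k * x k * y k)) :
    ∃ P N : Submodule ℝ (ℝ ⊗[ℚ] (Fin m → F)),
      IsCompl P N ∧
      Module.finrank ℝ P = Module.finrank ℚ F * m - 2 ∧
      Module.finrank ℝ N = 2 ∧
      (∀ x ∈ P, x ≠ 0 → 0 < LinearMap.BilinForm.baseChange ℝ ψ x x) ∧
      (∀ y ∈ N, y ≠ 0 → LinearMap.BilinForm.baseChange ℝ ψ y y < 0) ∧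
      (∀ x ∈ P, ∀ y ∈ N, LinearMap.BilinForm.baseChange ℝ ψ x y = 0) := by
  classical
  let T : Finset ((F →+* ℝ) × Fin m) := {(ε, ⟨0, by omega⟩), (ε, ⟨1, by omega⟩)}
  have hT : T.card = 2 := Finset.card_pair (by simp)
  have hcard : Fintype.card ((F →+* ℝ) × Fin m) = Module.finrank ℚ F * m := by
    simp [card_realEmbeddings F htr]
  rw [← hcard, ← hT]
  refine exists_isCompl_posDef_negDef (realEmbeddingsEquiv F htr m) (fun p ↦ p.1 (a p.2)) T
    ?_ ?_ _ (baseChange_trace_form_apply F htr m a ψ hψ)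
  · simp [T, h0, h1]
  · rintro ⟨σ, k⟩ hk
    by_cases hσε : σ = ε
    · subst hσε
      refine h2 k ?_
      by_contra! hlt
      apply hk
      have : (k : ℕ) = 0 ∨ (k : ℕ) = 1 := by omega
      simpa [T, Fin.ext_iff] using this
    · exact hσ σ hσε k
end

section
/- Let U be a finite-dimensional real vector space with a symmetric ℝ-bilinear form B, and suppose U = P ⊕ N with B(P, N) = 0, B positive definite on P, B negative definite on N, dim N = 2, and dim U = m ≥ 3. Let L be a countable set of nonzero ℝ-linear functionals on U. Then there exist x, y ∈ U with B(x, y) = 0, B(x, x) = B(y, y), B(x, x) < 0, and for every f ∈ L, f(x) ≠ 0 or f(y) ≠ 0. (Equivalently: the period domain {ω = x + iy ∈ U_ℂ : B_ℂ(ω, ω) = 0, B_ℂ(ω, ω̄) < 0} is nonempty and is not contained in the union of the countably many hyperplanes {ω : f_ℂ(ω) = 0}, f ∈ L.) -/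
open Polynomial in
/-- A nonzero functional vanishes at only finitely many points of the polynomial curve
`t ↦ v + ∑ i, t ^ (i + 1) • b i`, where `b` is a basis. -/
theorem finite_setOf_apply_basis_curve_eq_zero {U : Type*} [AddCommGroup U] [Module ℝ U] {n : ℕ}
    (b : Module.Basis (Fin n) ℝ U) (v : U) {f : U →ₗ[ℝ] ℝ} (hf : f ≠ 0) :
    {t : ℝ | f (v + ∑ i, t ^ (i.val + 1) • b i) = 0}.Finite := by
  obtain ⟨i, hi⟩ : ∃ i, f (b i) ≠ 0 := by
    by_contra! h
    exact hf (b.ext fun i => by simpa using h i)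
  let p : ℝ[X] := C (f v) + ∑ j : Fin n, X ^ (j.val + 1) * C (f (b j))
  have hp : p ≠ 0 := by
    intro h
    have hc : p.coeff (i.val + 1) = f (b i) := by
      simp [p, coeff_X_pow, Fin.val_inj]
    exact hi (by rw [← hc, h, coeff_zero])
  refine (finite_setOfPred_isRoot hp).subset fun t ht => ?_
  have heval : p.eval t = f (v + ∑ i, t ^ (i.val + 1) • b i) := by
    simp only [p, eval_add, eval_C, eval_finsetSum, eval_mul, eval_pow, eval_X, map_add, map_sum,
      map_smul, smul_eq_mul]
  exact heval.trans ht

/-- Countably many hyperplanes do not cover the negative cone of a bilinear form. -/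
theorem exists_neg_forall_apply_ne_zero {U : Type*} [AddCommGroup U] [Module ℝ U]
    [FiniteDimensional ℝ U] (B : LinearMap.BilinForm ℝ U) {v : U} (hv : B v v < 0)
    {L : Set (U →ₗ[ℝ] ℝ)} (hL : L.Countable) (hL0 : ∀ f ∈ L, f ≠ 0) :
    ∃ x : U, B x x < 0 ∧ ∀ f ∈ L, f x ≠ 0 := by
  let b := Module.finBasis ℝ U
  let x : ℝ → U := fun t => v + ∑ i, t ^ (i.val + 1) • b i
  have hcont : Continuous fun t => B (x t) (x t) := by
    simp only [x, map_add, map_sum, map_smul, LinearMap.add_apply, LinearMap.sum_apply,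
      LinearMap.smul_apply, smul_eq_mul]
    fun_prop
  have hopen : IsOpen {t | B (x t) (x t) < 0} := isOpen_lt hcont continuous_const
  have hcount : (⋃ f ∈ L, {t | f (x t) = 0}).Countable :=
    hL.biUnion fun f hf => (finite_setOf_apply_basis_curve_eq_zero b v (hL0 f hf)).countable
  obtain ⟨t, ht, htL⟩ := (hcount.dense_compl ℝ).inter_open_nonempty _ hopen
    ⟨0, by simpa [x] using hv⟩
  exact ⟨x t, ht, fun f hf h0 => htL (Set.mem_biUnion hf h0)⟩


/-- The period domain of a real quadratic space of signature `((m−2)+, 2−)`, `m ≥ 3`,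
is nonempty and not contained in the union of countably many hyperplanes: there is a
period `ω = x + iy` with `B(x,y) = 0`, `B(x,x) = B(y,y) < 0`, avoiding every functional
in the countable set `L`. -/
theorem period_domain_avoids_countably_many_hyperplanes
    (U : Type*) [AddCommGroup U] [Module ℝ U] [FiniteDimensional ℝ U]
    (B : LinearMap.BilinForm ℝ U) (hsymm : ∀ x y : U, B x y = B y x)
    (P N : Submodule ℝ U) (hcompl : IsCompl P N)
    (horth : ∀ p ∈ P, ∀ q ∈ N, B p q = 0)
    (hpos : ∀ p ∈ P, p ≠ 0 → 0 < B p p)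
    (hneg : ∀ q ∈ N, q ≠ 0 → B q q < 0)
    (hN : Module.finrank ℝ N = 2)
    (hU : 3 ≤ Module.finrank ℝ U)
    (L : Set (U →ₗ[ℝ] ℝ)) (hL : L.Countable) (hL0 : ∀ f ∈ L, f ≠ 0) :
    ∃ x y : U, B x y = 0 ∧ B x x = B y y ∧ B x x < 0 ∧
      ∀ f ∈ L, f x ≠ 0 ∨ f y ≠ 0 := by
  have : Nontrivial N := Module.nontrivial_of_finrank_pos (R := ℝ) (by omega)
  obtain ⟨v, hv⟩ := exists_ne (0 : N)
  obtain ⟨x, hx, hxL⟩ :=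
    exists_neg_forall_apply_ne_zero B (hneg v v.2 (by simpa using hv)) hL hL0
  obtain ⟨q, hq, hq0⟩ := ((B x ∘ₗ N.subtype).ker).exists_mem_ne_zero_of_ne_bot
    (LinearMap.ker_ne_bot_of_finrank_lt (by simp [hN]))
  have hxq : B x q = 0 := by simpa using hq
  have hqq : B q q < 0 := hneg q q.2 (by simpa using hq0)
  have hc : √(B x x / B q q) * √(B x x / B q q) = B x x / B q q :=
    Real.mul_self_sqrt (div_nonneg_of_nonpos hx.le hqq.le)
  refine ⟨x, √(B x x / B q q) • (q : U), by simp [hxq], ?_, hx, fun f hf => Or.inl (hxL f hf)⟩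
  simp only [map_smul, LinearMap.smul_apply, smul_eq_mul]
  rw [← mul_assoc, hc, div_mul_cancel₀ _ hqq.ne]
end

section
/- Let d be a positive odd integer that is not a perfect square and that is a sum of two integer squares, d = e² + c². Equip V = ℚ⁶ with the symmetric ℚ-bilinear form ψ(x, y) = x₁y₁ − x₂y₂ + x₃y₃ − x₄y₄ + x₅y₅ + x₆y₆. Then there exists a ℚ-linear endomorphism a of V such that ψ(a(v), w) = ψ(v, a(w)) for all v, w ∈ V, a ∘ a = d·id_V, and a is not a rational scalar multiple of the identity (so ℚ[a] is a field isomorphic to the real quadratic field ℚ(√d) acting on V by ψ-self-adjoint endomorphisms). -/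
/-- Example 3.4 (`double cover`): on `V = ℚ⁶` with the bilinear form
`ψ(x,y) = x₁y₁ − x₂y₂ + x₃y₃ − x₄y₄ + x₅y₅ + x₆y₆`, for any positive odd non-square
integer `d` which is a sum of two integer squares there is a `ψ`-self-adjoint
endomorphism `a` with `a² = d·id` which is not a rational multiple of the identity. -/
theorem real_multiplication_on_double_cover_lattice
    (d e c : ℤ) (hd : 0 < d) (hodd : Odd d) (hsq : ¬ IsSquare d)
    (hec : d = e ^ 2 + c ^ 2)
    (ψ : (Fin 6 → ℚ) → (Fin 6 → ℚ) → ℚ)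
    (hψ : ∀ x y : Fin 6 → ℚ, ψ x y =
      x 0 * y 0 - x 1 * y 1 + x 2 * y 2 - x 3 * y 3 + x 4 * y 4 + x 5 * y 5) :
    ∃ a : (Fin 6 → ℚ) →ₗ[ℚ] (Fin 6 → ℚ),
      (∀ v w : Fin 6 → ℚ, ψ (a v) w = ψ v (a w)) ∧
      a ∘ₗ a = (d : ℚ) • LinearMap.id ∧
      ¬ ∃ q : ℚ, a = q • LinearMap.id := by
  have hdq : (0 : ℚ) < d := by exact_mod_cast hd
  have hecq : (d : ℚ) = (e : ℚ) ^ 2 + (c : ℚ) ^ 2 := by exact_mod_cast hec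
  -- Use `p ^ 2 - q ^ 2 = d` on each hyperbolic plane and `e ^ 2 + c ^ 2 = d` on the definite plane.
  let p : ℚ := (d + 1) / 2
  let q : ℚ := (d - 1) / 2
  let A : Matrix (Fin 6) (Fin 6) ℚ :=
    !![p, q, 0, 0, 0, 0;
       -q, -p, 0, 0, 0, 0;
       0, 0, p, q, 0, 0;
       0, 0, -q, -p, 0, 0;
       0, 0, 0, 0, e, c;
       0, 0, 0, 0, c, -e]
  have hA : ∀ v : Fin 6 → ℚ, A.mulVecLin v =
      ![p * v 0 + q * v 1, -q * v 0 - p * v 1, p * v 2 + q * v 3, -q * v 2 - p * v 3,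
        e * v 4 + c * v 5, c * v 4 - e * v 5] := by
    intro v
    ext i
    fin_cases i <;> simp [A, Matrix.mulVec, dotProduct, Fin.sum_univ_succ] <;> ring
  refine ⟨A.mulVecLin, fun v w => ?_, ?_, ?_⟩
  · simp only [hψ, hA, Matrix.cons_val]
    ring
  · refine LinearMap.ext fun v => ?_
    rw [LinearMap.comp_apply, hA, hA]
    ext i
    fin_cases i <;> simp [p, q] <;> first | ring1 | (rw [hecq]; ring1)
  · rintro ⟨r, hr⟩
    have h₀ := congrFun (LinearMap.congr_fun hr ![1, 0, 0, 0, 0, 0]) 0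
    have h₁ := congrFun (LinearMap.congr_fun hr ![0, 1, 0, 0, 0, 0]) 1
    rw [hA] at h₀ h₁
    simp [p] at h₀ h₁
    linarith
end
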